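/- For every i with 1 ≤ i ≤ n−1 there exist positive constants l_1, …, l_i and C_i > 0 such that the function V_i(x_1,…,x_i) = Σ_{j=1}^i W_j(x_1,…,x_j) is C¹ on ℝ^i ∖ {0}, and for every (x_1, …, x_i) ∈ ℝ^i ∖ {0}, every x_{i+1} ∈ ℝ, and every (d_1, …, d_i) ∈ ℝ^i: Σ_{j=1}^i (∂V_i/∂x_j)(x_1,…,x_i)·(x_{j+1} + d_j) ≤ −Σ_{j=1}^i (l_j/2) |ω_j(x_1,…,x_j)|^{α_j} + ω_i(x_1,…,x_i)·(x_{i+1} − v_i(x_1,…,x_i)) + C_i Σ_{j=1}^i |d_j|^{η_j}, where α_j = 2p_2/(1 + p_2 − p_j) and η_j = 2p_2/p_{j+1}. -/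

import Mathlib

open MeasureTheory Filter Matrix

noncomputable section

/-- The signed power `⌊x⌉^a = |x|^a · sign x`. -/
def sgnPow (x a : ℝ) : ℝ := |x| ^ a * Real.sign x

/-- The exponents `p_i = 1 - (i-1)/n`. -/
def pe (n i : ℕ) : ℝ := 1 - ((i : ℝ) - 1) / n

/-- The exponents `β_0 = p_2`, `β_i = (n-1+i)/(n-i)`. -/
def be (n i : ℕ) : ℝ := if i = 0 then pe n 2 else ((n : ℝ) - 1 + i) / ((n : ℝ) - i)

/-- The exponent `α = 2(n-1)/(2n-1)`. -/
def al (n : ℕ) : ℝ := 2 * ((n : ℝ) - 1) / (2 * (n : ℝ) - 1)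

/-- The recursively defined virtual controls `v_i`; states are 1-indexed sequences
(the 0-th coordinate is unused). -/
def vfb (n : ℕ) (l : ℕ → ℝ) : ℕ → (ℕ → ℝ) → ℝ
  | 0, _ => 0
  | i + 1, x =>
    -l (i + 1) *
      sgnPow (sgnPow (x (i + 1)) (be n i) - sgnPow (vfb n l i x) (be n i))
        (pe n (i + 2) / (pe n (i + 1) * be n i))

/-- `ω_i(x_1,…,x_i) = ⌊x_i⌉^{β_{i-1}} - ⌊v_{i-1}⌉^{β_{i-1}}`. -/
def omfb (n : ℕ) (l : ℕ → ℝ) (i : ℕ) (x : ℕ → ℝ) : ℝ :=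
  sgnPow (x i) (be n (i - 1)) - sgnPow (vfb n l (i - 1) x) (be n (i - 1))

/-- `W_i`. -/
def Wfb (n : ℕ) (l : ℕ → ℝ) (i : ℕ) (x : ℕ → ℝ) : ℝ :=
  (|x i| ^ (be n (i - 1) + 1) - |vfb n l (i - 1) x| ^ (be n (i - 1) + 1)) / (be n (i - 1) + 1) -
    sgnPow (vfb n l (i - 1) x) (be n (i - 1)) * (x i - vfb n l (i - 1) x)

/-- Embedding of `ℝ^n` into 1-indexed sequences. -/
def emb (n : ℕ) (x : Fin n → ℝ) (j : ℕ) : ℝ :=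
  if h : 1 ≤ j ∧ j ≤ n then x ⟨j - 1, by omega⟩ else 0

/-- The Lyapunov function `V_n = Σ_{i=1}^n W_i` on `ℝ^n`. -/
def Vn (n : ℕ) (l : ℕ → ℝ) (x : Fin n → ℝ) : ℝ :=
  ∑ i ∈ Finset.Icc 1 n, Wfb n l i (emb n x)

/-- `ω_n` on `ℝ^n`. -/
def omn (n : ℕ) (l : ℕ → ℝ) (x : Fin n → ℝ) : ℝ := omfb n l n (emb n x)

/-- The `n`-th Jordan block: `(J_n)_{ij} = 1` if `i = j - 1` (1-indexed), else `0`. -/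
def Jmat (n : ℕ) : Matrix (Fin n) (Fin n) ℝ :=
  Matrix.of fun i j => if (i : ℕ) + 1 = (j : ℕ) then 1 else 0

/-- The `i`-th standard basis vector of `ℝ^n` (1-indexed: `eVec n n = e_n`). -/
def eVec (n i : ℕ) : Fin n → ℝ := fun j => if (j : ℕ) + 1 = i then 1 else 0

/-- The partial Lyapunov function `V_i = Σ_{j=1}^i W_j` on `ℝ^i`. -/
def Vi (n i : ℕ) (l : ℕ → ℝ) (x : Fin i → ℝ) : ℝ :=
  ∑ j ∈ Finset.Icc 1 i, Wfb n l j (emb i x)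


/-! ### Signed powers -/

section SignedPower

variable {a b x y : ℝ}

lemma sgnPow_zero (a : ℝ) : sgnPow 0 a = 0 := by simp [sgnPow]

lemma sgnPow_of_pos (hx : 0 < x) : sgnPow x a = x ^ a := by
  simp [sgnPow, Real.sign_of_pos hx, abs_of_pos hx]

lemma sgnPow_of_nonneg (ha : 0 < a) (hx : 0 ≤ x) : sgnPow x a = x ^ a := by
  rcases hx.eq_or_lt with rfl | hx
  · rw [sgnPow_zero, Real.zero_rpow ha.ne']
  · exact sgnPow_of_pos hx

lemma sgnPow_neg (x a : ℝ) : sgnPow (-x) a = -sgnPow x a := by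
  simp [sgnPow, Real.sign_neg]

lemma abs_sgnPow (ha : 0 < a) (x : ℝ) : |sgnPow x a| = |x| ^ a := by
  wlog hx : 0 ≤ x generalizing x
  · simpa [sgnPow_neg] using this (-x) (by linarith)
  rw [sgnPow_of_nonneg ha hx, abs_of_nonneg hx, abs_of_nonneg (by positivity)]

lemma sgnPow_one (x : ℝ) : sgnPow x 1 = x := by
  wlog hx : 0 ≤ x generalizing x
  · simpa [sgnPow_neg] using this (-x) (by linarith)
  rw [sgnPow_of_nonneg one_pos hx, Real.rpow_one]

lemma sgnPow_sgnPow (ha : 0 < a) (hb : 0 < b) (x : ℝ) :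
    sgnPow (sgnPow x a) b = sgnPow x (a * b) := by
  wlog hx : 0 ≤ x generalizing x
  · simpa [sgnPow_neg] using this (-x) (by linarith)
  rw [sgnPow_of_nonneg ha hx, sgnPow_of_nonneg hb (by positivity),
    sgnPow_of_nonneg (mul_pos ha hb) hx, Real.rpow_mul hx]

lemma sgnPow_const_mul {c : ℝ} (hc : 0 < c) (ha : 0 < a) (x : ℝ) :
    sgnPow (c * x) a = c ^ a * sgnPow x a := by
  wlog hx : 0 ≤ x generalizing x
  · simpa [sgnPow_neg] using this (-x) (by linarith)
  rw [sgnPow_of_nonneg ha (by positivity), sgnPow_of_nonneg ha hx, Real.mul_rpow hc.le hx]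

lemma mul_sgnPow_self (ha : 0 < a) (x : ℝ) : x * sgnPow x a = |x| ^ (a + 1) := by
  wlog hx : 0 ≤ x generalizing x
  · simpa [sgnPow_neg] using this (-x) (by linarith)
  rw [sgnPow_of_nonneg ha hx, abs_of_nonneg hx, Real.rpow_add_one' hx (by linarith), mul_comm]

lemma abs_rpow_mul_self (a x : ℝ) : |x| ^ (a - 1) * x = sgnPow x a := by
  wlog hx : 0 ≤ x generalizing x
  · simpa [sgnPow_neg] using this (-x) (by linarith)
  rcases hx.eq_or_lt with rfl | hx
  · simp [sgnPow_zero]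
  · rw [sgnPow_of_pos hx, abs_of_pos hx, Real.rpow_sub_one hx.ne']
    field_simp

lemma hasDerivAt_sgnPow (ha : 1 < a) (x : ℝ) :
    HasDerivAt (fun z => sgnPow z a) (a * |x| ^ (a - 1)) x := by
  have hpos : ∀ x : ℝ, 0 < x → HasDerivAt (fun z => sgnPow z a) (a * |x| ^ (a - 1)) x := by
    intro x hx
    rw [abs_of_pos hx]
    refine (Real.hasDerivAt_rpow_const (p := a) (Or.inl hx.ne')).congr_of_eventuallyEq ?_
    filter_upwards [eventually_gt_nhds hx] with z hz using sgnPow_of_pos hz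
  rcases lt_trichotomy x 0 with hx | rfl | hx
  · have h := ((hpos (-x) (by linarith)).comp x (hasDerivAt_neg x)).neg
    refine (h.congr_deriv ?_).congr_of_eventuallyEq ?_
    · simp
    · exact Eventually.of_forall fun z => by simp [sgnPow_neg]
  · rw [hasDerivAt_iff_tendsto_slope]
    have hc : Tendsto (fun z : ℝ => |z| ^ (a - 1)) (nhdsWithin 0 {0}ᶜ)
        (nhds (|(0 : ℝ)| ^ (a - 1))) :=
      ((continuous_abs.rpow_const fun _ => Or.inr (by linarith)).tendsto 0).mono_left
        nhdsWithin_le_nhds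
    have h0 : a * |(0 : ℝ)| ^ (a - 1) = |(0 : ℝ)| ^ (a - 1) := by
      rw [abs_zero, Real.zero_rpow (by linarith), mul_zero]
    rw [h0]
    refine hc.congr' ?_
    filter_upwards [self_mem_nhdsWithin] with z hz
    have hz : z ≠ 0 := hz
    rw [slope_def_field, sgnPow_zero, ← abs_rpow_mul_self a z]
    field_simp
    simp
  · exact hpos x hx

lemma contDiff_sgnPow (ha : 1 < a) : ContDiff ℝ 1 fun z => sgnPow z a := by
  rw [contDiff_one_iff_deriv]
  refine ⟨fun x => (hasDerivAt_sgnPow ha x).differentiableAt, ?_⟩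
  rw [funext fun x => (hasDerivAt_sgnPow ha x).deriv]
  exact (continuous_abs.rpow_const fun _ => Or.inr (by linarith)).const_mul a

lemma hasDerivAt_abs_rpow_sgnPow (ha : 0 < a) (x : ℝ) :
    HasDerivAt (fun z : ℝ => |z| ^ (a + 1)) ((a + 1) * sgnPow x a) x := by
  refine (hasDerivAt_abs_rpow x (by linarith)).congr_deriv ?_
  rw [← abs_rpow_mul_self a x]
  ring_nf

lemma contDiff_abs_rpow (ha : 1 < a) : ContDiff ℝ 1 fun z : ℝ => |z| ^ a :=
  contDiff_norm_rpow ha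

/-- The map `x ↦ ⌊x⌉^(1/b)` is Hölder continuous of exponent `1/b` when `1 ≤ b`. -/
lemma abs_sub_rpow_le (hb : 1 ≤ b) (x y : ℝ) :
    |x - y| ^ b ≤ 2 ^ b * |sgnPow x b - sgnPow y b| := by
  have hb0 : 0 < b := by linarith
  have h2 : (1 : ℝ) ≤ 2 ^ b := Real.one_le_rpow (by norm_num) hb0.le
  wlog hxy : |y| ≤ |x| generalizing x y
  · rw [abs_sub_comm, abs_sub_comm (sgnPow x b)]
    exact this y x (by linarith)
  wlog hx : 0 ≤ x generalizing x y
  · have := this (-x) (-y) (by simpa using hxy) (by linarith)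
    rwa [sgnPow_neg, sgnPow_neg, neg_sub_neg, neg_sub_neg, abs_sub_comm,
      abs_sub_comm (sgnPow y b)] at this
  rw [abs_of_nonneg hx] at hxy
  rw [sgnPow_of_nonneg hb0 hx]
  rcases le_total 0 y with hy | hy
  · rw [abs_of_nonneg hy] at hxy
    rw [sgnPow_of_nonneg hb0 hy, abs_of_nonneg (sub_nonneg.2 hxy),
      abs_of_nonneg (sub_nonneg.2 (Real.rpow_le_rpow hy hxy hb0.le))]
    have h := Real.add_rpow_le_rpow_add (sub_nonneg.2 hxy) hy hb
    rw [sub_add_cancel] at h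
    have h3 : 0 ≤ x ^ b - y ^ b := sub_nonneg.2 (Real.rpow_le_rpow hy hxy hb0.le)
    nlinarith
  · have hy' : 0 ≤ -y := by linarith
    rw [abs_of_nonpos hy] at hxy
    rw [← neg_neg y, sgnPow_neg, sgnPow_of_nonneg hb0 hy', sub_neg_eq_add, sub_neg_eq_add,
      abs_of_nonneg (by linarith), abs_of_nonneg (by positivity)]
    calc (x + -y) ^ b ≤ (2 * x) ^ b := Real.rpow_le_rpow (by linarith) (by linarith) hb0.le
      _ = 2 ^ b * x ^ b := Real.mul_rpow (by norm_num) hx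
      _ ≤ 2 ^ b * (x ^ b + (-y) ^ b) := by
        have : 0 ≤ (-y) ^ b := by positivity
        gcongr
        linarith

end SignedPower

/-- A weighted form of Young's inequality. -/
lemma exists_rpow_mul_rpow_le {a b s δ : ℝ} (ha : 0 < a) (hb : 0 < b) (hs : a + b = s)
    (hδ : 0 < δ) :
    ∃ K, 0 ≤ K ∧ ∀ r M : ℝ, 0 ≤ r → 0 ≤ M → r ^ a * M ^ b ≤ δ * M ^ s + K * r ^ s := by
  subst hs
  set ε := δ ^ (1 / a) with hε
  have hε0 : 0 < ε := by positivity
  refine ⟨ε⁻¹ ^ b, by positivity, fun r M hr hM => ?_⟩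
  rw [Real.rpow_add_of_nonneg hM ha.le hb.le, Real.rpow_add_of_nonneg hr ha.le hb.le]
  rcases le_total r (ε * M) with h | h
  · have h1 : r ^ a ≤ δ * M ^ a := by
      calc r ^ a ≤ (ε * M) ^ a := Real.rpow_le_rpow hr h ha.le
        _ = δ * M ^ a := by
          rw [Real.mul_rpow hε0.le hM, hε, ← Real.rpow_mul hδ.le, one_div_mul_cancel ha.ne',
            Real.rpow_one]
    have h2 : 0 ≤ ε⁻¹ ^ b * (r ^ a * r ^ b) := by positivity
    have h3 := mul_le_mul_of_nonneg_right h1 (Real.rpow_nonneg hM b)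
    linarith
  · have h1 : M ^ b ≤ ε⁻¹ ^ b * r ^ b := by
      rw [← Real.mul_rpow (by positivity) hr]
      refine Real.rpow_le_rpow hM ?_ hb.le
      rwa [inv_mul_eq_div, le_div_iff₀ hε0, mul_comm]
    have h2 : 0 ≤ δ * (M ^ a * M ^ b) := by positivity
    have h3 := mul_le_mul_of_nonneg_left h1 (Real.rpow_nonneg hr a)
    linarith

/-! ### The homogeneity weights -/

/-- The homogeneity weight of `ω_j`. -/
def qe (n j : ℕ) : ℝ := 1 + pe n 2 - pe n j

section Weights

variable {n j : ℕ}

lemma pe_succ (n j : ℕ) : pe n (j + 1) = pe n j - 1 / n := by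
  simp only [pe]
  push_cast
  ring

lemma qe_succ (n j : ℕ) : qe n (j + 1) = qe n j + 1 / n := by
  simp only [qe, pe_succ n j]
  ring

lemma pe_eq_div (hn : 2 ≤ n) (j : ℕ) : pe n j = ((n : ℝ) - j + 1) / n := by
  have : (n : ℝ) ≠ 0 := by positivity
  simp only [pe]
  field_simp
  ring

lemma qe_eq_div (hn : 2 ≤ n) (j : ℕ) : qe n j = ((n : ℝ) + j - 2) / n := by
  have : (n : ℝ) ≠ 0 := by positivity
  rw [qe, pe_eq_div hn, pe_eq_div hn]
  field_simp
  push_cast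
  ring

lemma pe_pos (hn : 2 ≤ n) (hj : j ≤ n) : 0 < pe n j := by
  rw [pe_eq_div hn]
  have : (j : ℝ) ≤ n := by exact_mod_cast hj
  have : (2 : ℝ) ≤ n := by exact_mod_cast hn
  apply div_pos <;> linarith

lemma qe_pos (hn : 2 ≤ n) (hj : 1 ≤ j) : 0 < qe n j := by
  rw [qe_eq_div hn]
  have : (1 : ℝ) ≤ j := by exact_mod_cast hj
  have : (2 : ℝ) ≤ n := by exact_mod_cast hn
  apply div_pos <;> linarith

lemma qe_add_pe_succ (hn : 2 ≤ n) (j : ℕ) : qe n j + pe n (j + 1) = 2 * pe n 2 := by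
  have : (n : ℝ) ≠ 0 := by positivity
  rw [qe_eq_div hn, pe_eq_div hn, pe_eq_div hn]
  field_simp
  push_cast
  ring

lemma pe_mul_be (hn : 2 ≤ n) (hj : j < n) : pe n (j + 1) * be n j = qe n (j + 1) := by
  have h0 : (n : ℝ) ≠ 0 := by positivity
  have h1 : (n : ℝ) - j ≠ 0 := by
    have : (j : ℝ) < n := by exact_mod_cast hj
    linarith
  rw [qe_eq_div hn, pe_eq_div hn, be]
  split_ifs with h
  · subst h
    rw [pe_eq_div hn]
    push_cast
    field_simp
    ring
  · push_cast
    rw [show (n : ℝ) - (j + 1) + 1 = n - j by ring]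
    field_simp
    ring

lemma be_pos (hn : 2 ≤ n) (hj : j < n) : 0 < be n j := by
  have h := pe_mul_be hn hj
  exact pos_of_mul_pos_right (h ▸ qe_pos hn (by omega)) (pe_pos hn hj).le

lemma one_lt_be (h1 : 1 ≤ j) (hj : j < n) : 1 < be n j := by
  have : (j : ℝ) < n := by exact_mod_cast hj
  have : (1 : ℝ) ≤ j := by exact_mod_cast h1
  rw [be, if_neg (by omega), one_lt_div (by linarith)]
  linarith

lemma one_lt_qe_div (hn : 2 ≤ n) (hj : 1 ≤ j) : 1 < qe n (j + 1) / qe n j := by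
  rw [one_lt_div (qe_pos hn hj), qe_succ]
  have : (0 : ℝ) < 1 / n := by positivity
  linarith

end Weights

/-! ### The virtual controls and their powers -/

/-- The power `⌊v_j⌉^{β_j}` of the virtual control. -/
def vpow (n : ℕ) (l : ℕ → ℝ) (j : ℕ) (x : ℕ → ℝ) : ℝ := sgnPow (vfb n l j x) (be n j)

section Controls

variable {n j : ℕ} {l : ℕ → ℝ}

lemma vfb_congr {l' : ℕ → ℝ} (h : ∀ k ≤ j, l k = l' k) (x : ℕ → ℝ) :
    vfb n l j x = vfb n l' j x := by
  induction j with
  | zero => rfl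
  | succ j ih => simp only [vfb, h _ le_rfl, ih fun k hk => h k (by omega)]

lemma omfb_congr {l' : ℕ → ℝ} (h : ∀ k < j, l k = l' k) (hj : 1 ≤ j) (x : ℕ → ℝ) :
    omfb n l j x = omfb n l' j x := by
  simp only [omfb, vfb_congr fun k (hk : k ≤ j - 1) => h k (by omega)]

lemma Wfb_congr {l' : ℕ → ℝ} (h : ∀ k < j, l k = l' k) (hj : 1 ≤ j) (x : ℕ → ℝ) :
    Wfb n l j x = Wfb n l' j x := by
  simp only [Wfb, vfb_congr fun k (hk : k ≤ j - 1) => h k (by omega)]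

lemma omfb_succ (j : ℕ) (x : ℕ → ℝ) :
    omfb n l (j + 1) x = sgnPow (x (j + 1)) (be n j) - vpow n l j x := rfl

lemma vpow_zero (x : ℕ → ℝ) : vpow n l 0 x = 0 := sgnPow_zero _

lemma vfb_succ (hn : 2 ≤ n) (hj : j < n) (x : ℕ → ℝ) :
    vfb n l (j + 1) x =
      -(l (j + 1) * sgnPow (omfb n l (j + 1) x) (pe n (j + 2) / qe n (j + 1))) := by
  rw [vfb, omfb_succ, ← pe_mul_be hn hj, vpow, neg_mul]

lemma vpow_succ (hn : 2 ≤ n) (hl : ∀ j, 0 < l j) (hj : j + 1 < n) (x : ℕ → ℝ) :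
    vpow n l (j + 1) x = -(l (j + 1) ^ be n (j + 1) *
      sgnPow (omfb n l (j + 1) x) (qe n (j + 2) / qe n (j + 1))) := by
  have hq : 0 < qe n (j + 1) := qe_pos hn (by omega)
  rw [vpow, vfb_succ hn (by omega), sgnPow_neg, sgnPow_const_mul (hl _) (be_pos hn hj),
    sgnPow_sgnPow (div_pos (pe_pos hn (by omega)) hq) (be_pos hn hj), div_mul_eq_mul_div,
    pe_mul_be hn hj]

lemma vpow_one (hn : 2 ≤ n) (hl : ∀ j, 0 < l j) (x : ℕ → ℝ) :
    vpow n l 1 x = -(l 1 ^ be n 1 * x 1) := by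
  have hq : 0 < qe n 1 := qe_pos hn le_rfl
  have h2 : qe n 2 = 1 := by simp [qe]
  have h1 : be n 0 = qe n 1 := by simp [be, qe, pe]
  rw [vpow_succ hn hl (by omega), omfb_succ, vpow_zero, sub_zero,
    sgnPow_sgnPow (be_pos hn (by omega)) (div_pos (qe_pos hn (by omega)) hq), h1,
    mul_div_cancel₀ _ hq.ne', zero_add, h2, sgnPow_one]

lemma sgnPow_vpow (hn : 2 ≤ n) (hj : j < n) (x : ℕ → ℝ) :
    sgnPow (vpow n l j x) (1 / be n j) = vfb n l j x := by
  have hb := be_pos hn hj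
  rw [vpow, sgnPow_sgnPow hb (by positivity), mul_one_div_cancel hb.ne', sgnPow_one]

lemma Wfb_succ_eq (hn : 2 ≤ n) (hj : j < n) (x : ℕ → ℝ) :
    Wfb n l (j + 1) x = |x (j + 1)| ^ (be n j + 1) / (be n j + 1) +
      be n j / (be n j + 1) * |vpow n l j x| ^ (1 / be n j + 1) - vpow n l j x * x (j + 1) := by
  have hb := be_pos hn hj
  have h1 : |vpow n l j x| ^ (1 / be n j + 1) = |vfb n l j x| ^ (be n j + 1) := by
    rw [vpow, abs_sgnPow hb, ← Real.rpow_mul (abs_nonneg _)]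
    congr 1
    field_simp
    ring
  have h2 := mul_sgnPow_self hb (vfb n l j x)
  rw [Wfb, h1, ← h2, vpow, Nat.add_sub_cancel, ← h2]
  field_simp
  ring

lemma omfb_mul_vfb (hn : 2 ≤ n) (hj : j + 1 < n) (x : ℕ → ℝ) :
    omfb n l (j + 1) x * vfb n l (j + 1) x =
      -(l (j + 1) * |omfb n l (j + 1) x| ^ (2 * pe n 2 / qe n (j + 1))) := by
  have hq : 0 < qe n (j + 1) := qe_pos hn (by omega)
  have hp : 0 < pe n (j + 2) := pe_pos hn (by omega)
  rw [vfb_succ hn (by omega), ← qe_add_pe_succ hn (j + 1), add_div, div_self hq.ne', add_comm 1,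
    ← mul_sgnPow_self (by positivity)]
  ring

/-! ### Smoothness -/

lemma contDiff_vpow {E : Type*} [NormedAddCommGroup E] [NormedSpace ℝ E] (hn : 2 ≤ n)
    (hl : ∀ j, 0 < l j) {f : E → ℕ → ℝ} (hf : ∀ k, ContDiff ℝ 1 fun e => f e k) (hj : j < n) :
    ContDiff ℝ 1 fun e => vpow n l j (f e) := by
  induction j with
  | zero => simpa only [vpow_zero] using contDiff_const
  | succ j ih =>
    rcases Nat.eq_zero_or_pos j with rfl | hj0
    · simp only [zero_add, vpow_one hn hl]
      exact (contDiff_const.mul (hf 1)).neg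
    · simp only [vpow_succ hn hl hj, omfb_succ]
      exact (contDiff_const.mul ((contDiff_sgnPow (one_lt_qe_div hn (by omega))).comp
        (((contDiff_sgnPow (one_lt_be hj0 (by omega))).comp (hf _)).sub (ih (by omega))))).neg

lemma contDiff_Wfb {E : Type*} [NormedAddCommGroup E] [NormedSpace ℝ E] (hn : 2 ≤ n)
    (hl : ∀ j, 0 < l j) {f : E → ℕ → ℝ} (hf : ∀ k, ContDiff ℝ 1 fun e => f e k) (hj : j < n) :
    ContDiff ℝ 1 fun e => Wfb n l (j + 1) (f e) := by
  have hb := be_pos hn hj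
  have hb' : 1 < 1 / be n j + 1 := by
    have : 0 < 1 / be n j := by positivity
    linarith
  have hu := contDiff_vpow hn hl hf hj
  simp only [Wfb_succ_eq hn hj]
  exact ((((contDiff_abs_rpow (by linarith)).comp (hf _)).div_const _).add
    (contDiff_const.mul ((contDiff_abs_rpow hb').comp hu))).sub (hu.mul (hf _))

lemma hasDerivAt_Wfb (hn : 2 ≤ n) (hj : j < n) {γ : ℝ → ℕ → ℝ} {t y D : ℝ}
    (hγ : HasDerivAt (fun s => γ s (j + 1)) y t)
    (hD : HasDerivAt (fun s => vpow n l j (γ s)) D t) :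
    HasDerivAt (fun s => Wfb n l (j + 1) (γ s))
      (omfb n l (j + 1) (γ t) * y + (vfb n l j (γ t) - γ t (j + 1)) * D) t := by
  have hb := be_pos hn hj
  simp only [Wfb_succ_eq hn hj]
  have h1 := ((hasDerivAt_abs_rpow_sgnPow hb _).comp t hγ).div_const (be n j + 1)
  have h2 := ((hasDerivAt_abs_rpow_sgnPow (one_div_pos.2 hb) _).comp t hD).const_mul
    (be n j / (be n j + 1))
  refine ((h1.add h2).sub (hD.mul hγ)).congr_deriv ?_
  rw [sgnPow_vpow hn hj, omfb_succ]
  field_simp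
  ring

/-! ### Homogeneous bounds -/

lemma abs_vpow_succ_le (hn : 2 ≤ n) (hl : ∀ j, 0 < l j) (hj : j + 1 < n) {x : ℕ → ℝ} {M : ℝ}
    (hM : 0 ≤ M) (h : |omfb n l (j + 1) x| ≤ M ^ qe n (j + 1)) :
    |vpow n l (j + 1) x| ≤ l (j + 1) ^ be n (j + 1) * M ^ qe n (j + 2) := by
  have hq : 0 < qe n (j + 1) := qe_pos hn (by omega)
  have hq' : 0 < qe n (j + 2) := qe_pos hn (by omega)
  have hl' := Real.rpow_nonneg (hl (j + 1)).le (be n (j + 1))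
  rw [vpow_succ hn hl hj, abs_neg, abs_mul, abs_of_nonneg hl', abs_sgnPow (by positivity)]
  refine mul_le_mul_of_nonneg_left ?_ hl'
  calc |omfb n l (j + 1) x| ^ (qe n (j + 2) / qe n (j + 1))
      ≤ (M ^ qe n (j + 1)) ^ (qe n (j + 2) / qe n (j + 1)) :=
        Real.rpow_le_rpow (abs_nonneg _) h (by positivity)
    _ = M ^ qe n (j + 2) := by rw [← Real.rpow_mul hM, mul_div_cancel₀ _ (ne_of_gt hq)]

/-- The states are bounded homogeneously in terms of the `ω_k`. -/
lemma exists_abs_state_le (hn : 2 ≤ n) (hl : ∀ j, 0 < l j) (hj : j < n) :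
    ∃ K, 0 ≤ K ∧ ∀ (x : ℕ → ℝ) (M : ℝ), 0 ≤ M →
      (∀ k, 1 ≤ k → k ≤ j + 1 → |omfb n l k x| ≤ M ^ qe n k) →
      |x (j + 1)| ≤ K * M ^ pe n (j + 1) := by
  have hb := be_pos hn hj
  obtain ⟨L, hL, hLu⟩ : ∃ L, 0 ≤ L ∧ ∀ (x : ℕ → ℝ) (M : ℝ), 0 ≤ M →
      (∀ k, 1 ≤ k → k ≤ j + 1 → |omfb n l k x| ≤ M ^ qe n k) →
      |vpow n l j x| ≤ L * M ^ qe n (j + 1) := by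
    cases j with
    | zero => exact ⟨0, le_rfl, fun x M _ _ => by simp [vpow_zero]⟩
    | succ j =>
      exact ⟨l (j + 1) ^ be n (j + 1), Real.rpow_nonneg (hl _).le _, fun x M hM h =>
        abs_vpow_succ_le hn hl hj hM (h _ (by omega) (by omega))⟩
  refine ⟨(1 + L) ^ (1 / be n j), by positivity, fun x M hM h => ?_⟩
  have h1 : |x (j + 1)| ^ be n j ≤ (1 + L) * M ^ qe n (j + 1) := by
    rw [← abs_sgnPow hb]
    have h2 := h (j + 1) (by omega) le_rfl
    have h3 := hLu x M hM h
    have h4 : sgnPow (x (j + 1)) (be n j) = omfb n l (j + 1) x + vpow n l j x := by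
      rw [omfb_succ]
      ring
    rw [h4]
    linarith [abs_add_le (omfb n l (j + 1) x) (vpow n l j x)]
  rw [← Real.rpow_le_rpow_iff (abs_nonneg _) (by positivity) hb]
  refine h1.trans_eq ?_
  rw [Real.mul_rpow (by positivity) (by positivity), ← Real.rpow_mul (by positivity),
    ← Real.rpow_mul hM, one_div_mul_cancel hb.ne', Real.rpow_one, pe_mul_be hn hj]

/-- The derivative of `⌊v_{j+1}⌉^{β_{j+1}}` along a curve is bounded homogeneously. -/
lemma exists_hasDerivAt_vpow_le (hn : 2 ≤ n) (hl : ∀ j, 0 < l j) {A : ℕ → ℝ}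
    (hA : ∀ k, 0 ≤ A k) (hj : j + 1 < n) :
    ∃ K, 0 ≤ K ∧ ∀ (γ : ℝ → ℕ → ℝ) (y : ℕ → ℝ) (t M : ℝ), 0 ≤ M →
      (∀ k, 1 ≤ k → k ≤ j + 1 → HasDerivAt (fun s => γ s k) (y k) t) →
      (∀ k, 1 ≤ k → k ≤ j + 1 → |omfb n l k (γ t)| ≤ M ^ qe n k) →
      (∀ k, 1 ≤ k → k ≤ j + 1 → |y k| ≤ A k * M ^ pe n (k + 1)) →
      ∃ D, HasDerivAt (fun s => vpow n l (j + 1) (γ s)) D t ∧ |D| ≤ K * M ^ qe n (j + 1) := by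
  induction j with
  | zero =>
    refine ⟨l 1 ^ be n 1 * A 1, mul_nonneg (Real.rpow_nonneg (hl 1).le _) (hA 1),
      fun γ y t M hM hγ hω hy => ⟨-(l 1 ^ be n 1 * y 1), ?_, ?_⟩⟩
    · simp only [zero_add, vpow_one hn hl]
      exact ((hγ 1 le_rfl le_rfl).const_mul _).neg
    · have hl' := Real.rpow_nonneg (hl 1).le (be n 1)
      have hq : pe n 2 = qe n 1 := by simp [qe, pe]
      have := hy 1 le_rfl le_rfl
      rw [hq] at this
      rw [abs_neg, abs_mul, abs_of_nonneg hl', mul_assoc]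
      exact mul_le_mul_of_nonneg_left this hl'
  | succ j ih =>
    obtain ⟨K, hK, hKD⟩ := ih (by omega)
    obtain ⟨B, hB, hBx⟩ := exists_abs_state_le (l := l) hn hl (j := j + 1) (by omega)
    have hβ : 1 < be n (j + 1) := one_lt_be (by omega) (by omega)
    have hq : 0 < qe n (j + 2) := qe_pos hn (by omega)
    have he : 1 < qe n (j + 3) / qe n (j + 2) := one_lt_qe_div hn (by omega)
    have hl' := Real.rpow_nonneg (hl (j + 2)).le (be n (j + 2))
    have hA' := hA (j + 2)
    have hp : 0 < pe n (j + 3) := pe_pos hn (by omega)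
    have hq1 : 0 < qe n (j + 1) := qe_pos hn (by omega)
    set β := be n (j + 1) with hβdef
    set e := qe n (j + 3) / qe n (j + 2) with hedef
    refine ⟨l (j + 2) ^ be n (j + 2) * (e * (β * (B ^ (β - 1) * A (j + 2)) + K)), by positivity,
      fun γ y t M hM hγ hω hy => ?_⟩
    obtain ⟨D, hD, hDle⟩ := hKD γ y t M hM (fun k h1 h2 => hγ k h1 (by omega))
      (fun k h1 h2 => hω k h1 (by omega)) (fun k h1 h2 => hy k h1 (by omega))
    have hx := hBx (γ t) M hM hω
    have hdω : HasDerivAt (fun s => omfb n l (j + 2) (γ s))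
        (β * |γ t (j + 2)| ^ (β - 1) * y (j + 2) - D) t :=
      ((hasDerivAt_sgnPow hβ _).comp t (hγ (j + 2) (by omega) le_rfl)).sub hD
    refine ⟨-(l (j + 2) ^ be n (j + 2) * (e * |omfb n l (j + 2) (γ t)| ^ (e - 1) *
      (β * |γ t (j + 2)| ^ (β - 1) * y (j + 2) - D))), ?_, ?_⟩
    · simp only [vpow_succ hn hl hj]
      exact (((hasDerivAt_sgnPow he _).comp t hdω).const_mul _).neg
    · have hωle : |omfb n l (j + 2) (γ t)| ^ (e - 1) ≤ M ^ (1 / n : ℝ) := by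
        calc |omfb n l (j + 2) (γ t)| ^ (e - 1) ≤ (M ^ qe n (j + 2)) ^ (e - 1) :=
              Real.rpow_le_rpow (abs_nonneg _) (hω _ (by omega) le_rfl) (by linarith)
          _ = M ^ (1 / n : ℝ) := by
            rw [← Real.rpow_mul hM, mul_sub, hedef, mul_div_cancel₀ _ hq.ne', qe_succ n (j + 2)]
            ring_nf
      have hxle : |γ t (j + 2)| ^ (β - 1) ≤ B ^ (β - 1) * M ^ (pe n (j + 2) * (β - 1)) := by
        rw [Real.rpow_mul hM, ← Real.mul_rpow hB (by positivity)]
        exact Real.rpow_le_rpow (abs_nonneg _) hx (by linarith)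
      have hdωle : |β * |γ t (j + 2)| ^ (β - 1) * y (j + 2) - D| ≤
          (β * (B ^ (β - 1) * A (j + 2)) + K) * M ^ qe n (j + 1) := by
        have hexp : M ^ (pe n (j + 2) * (β - 1)) * M ^ pe n (j + 3) = M ^ qe n (j + 1) := by
          rw [← Real.rpow_add_of_nonneg hM
            (mul_nonneg (pe_pos hn (by omega)).le (by linarith)) hp.le, mul_sub,
            pe_mul_be hn (by omega), pe_succ n (j + 2), qe_succ n (j + 1)]
          ring_nf
        have hyle := hy (j + 2) (by omega) le_rfl
        calc |β * |γ t (j + 2)| ^ (β - 1) * y (j + 2) - D|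
            ≤ |β * |γ t (j + 2)| ^ (β - 1) * y (j + 2)| + |D| := abs_sub _ _
          _ = β * (|γ t (j + 2)| ^ (β - 1) * |y (j + 2)|) + |D| := by
            rw [abs_mul, abs_of_nonneg (by positivity), mul_assoc]
          _ ≤ β * (B ^ (β - 1) * M ^ (pe n (j + 2) * (β - 1)) *
                (A (j + 2) * M ^ pe n (j + 3))) + K * M ^ qe n (j + 1) := by
            gcongr
          _ = (β * (B ^ (β - 1) * A (j + 2)) + K) * M ^ qe n (j + 1) := by
            rw [← hexp]
            ring
      rw [abs_neg, abs_mul, abs_of_nonneg hl', abs_mul, abs_of_nonneg (by positivity),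
        mul_assoc (l (j + 2) ^ _)]
      refine mul_le_mul_of_nonneg_left ?_ hl'
      calc e * |omfb n l (j + 2) (γ t)| ^ (e - 1) *
            |β * |γ t (j + 2)| ^ (β - 1) * y (j + 2) - D|
          ≤ e * M ^ (1 / n : ℝ) *
            ((β * (B ^ (β - 1) * A (j + 2)) + K) * M ^ qe n (j + 1)) := by gcongr
        _ = e * (β * (B ^ (β - 1) * A (j + 2)) + K) * M ^ qe n (j + 2) := by
          rw [qe_succ n (j + 1), Real.rpow_add_of_nonneg hM hq1.le (by positivity)]
          ring

/-- The tracking error `x_{j+1} - v_j` is controlled by `ω_{j+1}`. -/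
lemma abs_vfb_sub_le (hn : 2 ≤ n) (h1 : 1 ≤ j) (hj : j < n) (x : ℕ → ℝ) :
    |vfb n l j x - x (j + 1)| ≤
      2 * (|omfb n l (j + 1) x| ^ (1 / qe n (j + 1))) ^ pe n (j + 1) := by
  have hb := one_lt_be h1 hj
  have hq : 0 < qe n (j + 1) := qe_pos hn (by omega)
  rw [← Real.rpow_le_rpow_iff (abs_nonneg _) (by positivity) (by linarith : 0 < be n j),
    abs_sub_comm]
  refine (abs_sub_rpow_le hb.le _ _).trans_eq ?_
  rw [Real.mul_rpow (by norm_num) (by positivity), ← Real.rpow_mul (by positivity),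
    pe_mul_be hn hj, ← Real.rpow_mul (by positivity), one_div_mul_cancel hq.ne', Real.rpow_one,
    omfb_succ, vpow]

end Controls

/-! ### The backstepping induction -/

lemma abs_le_rpow_of_rpow_div_le {w q s S : ℝ} (hq : 0 < q) (hs : 0 < s)
    (h : |w| ^ (s / q) ≤ S) : |w| ≤ (S ^ (1 / s)) ^ q := by
  have hS : 0 ≤ S := (by positivity : 0 ≤ |w| ^ (s / q)).trans h
  calc |w| = (|w| ^ (s / q)) ^ (1 / s * q) := by
        rw [← Real.rpow_mul (abs_nonneg _)]
        field_simp
        rw [Real.rpow_one]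
    _ ≤ S ^ (1 / s * q) := Real.rpow_le_rpow (by positivity) h (by positivity)
    _ = _ := Real.rpow_mul hS _ _

section Backstepping

variable {n i : ℕ} {l : ℕ → ℝ}

/-- Young's inequality for the term in which the perturbation `d_j` meets `ω_j`. -/
lemma exists_mul_le_rpow {q p s δ : ℝ} (hq : 0 < q) (hp : 0 < p) (hs : q + p = s) (hδ : 0 < δ) :
    ∃ K, 0 ≤ K ∧ ∀ w d M : ℝ, 0 ≤ M → |d| ≤ M ^ p →
      w * d ≤ δ * M ^ s + K * |w| ^ (s / q) := by
  obtain ⟨K, hK, h⟩ := exists_rpow_mul_rpow_le hq hp hs hδ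
  refine ⟨K, hK, fun w d M hM hd => ?_⟩
  have hw := h (|w| ^ (1 / q)) M (by positivity) hM
  rw [← Real.rpow_mul (abs_nonneg _), ← Real.rpow_mul (abs_nonneg _), one_div_mul_cancel hq.ne',
    Real.rpow_one, one_div_mul_eq_div] at hw
  refine le_trans ?_ hw
  calc w * d ≤ |w * d| := le_abs_self _
    _ = |w| * |d| := abs_mul _ _
    _ ≤ |w| * M ^ p := by gcongr

/-- All terms created by adding `W_{i+1}` to `V_i` can be absorbed, up to a multiple of
`|ω_{i+1}|^{α_{i+1}}`, in an arbitrarily small multiple of the dissipation and the disturbances. -/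
lemma exists_cross_terms_le (hn : 2 ≤ n) (hl : ∀ j, 0 < l j) (hi1 : 1 ≤ i) (hi : i + 1 < n)
    {δ : ℝ} (hδ : 0 < δ) :
    ∃ K, 0 ≤ K ∧ ∀ (γ : ℝ → ℕ → ℝ) (x y d : ℕ → ℝ) (t : ℝ), γ t = x →
      (∀ k, HasDerivAt (fun s => γ s k) (y k) t) →
      (∀ k, 1 ≤ k → k ≤ i → y k = x (k + 1) + d k) →
      ∃ D, HasDerivAt (fun s => vpow n l i (γ s)) D t ∧
        omfb n l i x * (x (i + 1) - vfb n l i x) + (vfb n l i x - x (i + 1)) * D +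
          omfb n l (i + 1) x * d (i + 1) ≤
        δ * (∑ j ∈ Finset.Icc 1 (i + 1), |omfb n l j x| ^ (2 * pe n 2 / qe n j) +
          ∑ j ∈ Finset.Icc 1 (i + 1), |d j| ^ (2 * pe n 2 / pe n (j + 1))) +
        K * |omfb n l (i + 1) x| ^ (2 * pe n 2 / qe n (i + 1)) := by
  have hs : 0 < 2 * pe n 2 := mul_pos two_pos (pe_pos hn hn)
  have hB : ∀ k, ∃ B, 0 ≤ B ∧ (k < n → ∀ (x : ℕ → ℝ) (M : ℝ), 0 ≤ M →
      (∀ m, 1 ≤ m → m ≤ k + 1 → |omfb n l m x| ≤ M ^ qe n m) →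
      |x (k + 1)| ≤ B * M ^ pe n (k + 1)) := by
    intro k
    by_cases hk : k < n
    · obtain ⟨B, hB, h⟩ := exists_abs_state_le (l := l) hn hl hk
      exact ⟨B, hB, fun _ => h⟩
    · exact ⟨0, le_rfl, fun h => absurd h hk⟩
  choose B hB0 hB using hB
  obtain ⟨j, rfl⟩ : ∃ j, i = j + 1 := ⟨i - 1, by omega⟩
  obtain ⟨L, hL, hLD⟩ := exists_hasDerivAt_vpow_le (l := l) hn hl (A := fun k => B k + 1)
    (fun k => add_nonneg (hB0 k) one_pos.le) (j := j) (by omega)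
  have hq : 0 < qe n (j + 2) := qe_pos hn (by omega)
  have hq1 : 0 < qe n (j + 1) := qe_pos hn (by omega)
  have hp : 0 < pe n (j + 2) := pe_pos hn (by omega)
  obtain ⟨K₁, hK₁, hY₁⟩ := exists_rpow_mul_rpow_le hp hq1
    ((add_comm _ _).trans (qe_add_pe_succ hn (j + 1))) (δ := δ / 2 / (2 * (1 + L)))
    (by positivity)
  obtain ⟨K₂, hK₂, hY₂⟩ := exists_mul_le_rpow hq (pe_pos hn (by omega))
    (qe_add_pe_succ hn (j + 2)) (half_pos hδ)
  refine ⟨2 * (1 + L) * K₁ + K₂, by positivity, fun γ x y d t hx hγ hy => ?_⟩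
  set S := ∑ j ∈ Finset.Icc 1 (j + 1 + 1), |omfb n l j x| ^ (2 * pe n 2 / qe n j) +
    ∑ j ∈ Finset.Icc 1 (j + 1 + 1), |d j| ^ (2 * pe n 2 / pe n (j + 1)) with hSdef
  have hS1 : 0 ≤ ∑ j ∈ Finset.Icc 1 (j + 1 + 1), |omfb n l j x| ^ (2 * pe n 2 / qe n j) :=
    Finset.sum_nonneg fun _ _ => by positivity
  have hS2 : 0 ≤ ∑ j ∈ Finset.Icc 1 (j + 1 + 1), |d j| ^ (2 * pe n 2 / pe n (j + 1)) :=
    Finset.sum_nonneg fun _ _ => by positivity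
  have hS : 0 ≤ S := add_nonneg hS1 hS2
  set M := S ^ (1 / (2 * pe n 2)) with hMdef
  have hM : 0 ≤ M := by positivity
  have hMS : M ^ (2 * pe n 2) = S := by
    rw [hMdef, ← Real.rpow_mul hS, one_div_mul_cancel hs.ne', Real.rpow_one]
  have hω : ∀ k, 1 ≤ k → k ≤ j + 1 + 1 → |omfb n l k x| ≤ M ^ qe n k := by
    intro k h1 h2
    refine abs_le_rpow_of_rpow_div_le (qe_pos hn h1) hs ?_
    have := Finset.single_le_sum (f := fun j => |omfb n l j x| ^ (2 * pe n 2 / qe n j))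
      (fun _ _ => by positivity) (Finset.mem_Icc.2 ⟨h1, h2⟩)
    exact this.trans (le_add_of_nonneg_right hS2)
  have hd : ∀ k, 1 ≤ k → k ≤ j + 1 + 1 → |d k| ≤ M ^ pe n (k + 1) := by
    intro k h1 h2
    refine abs_le_rpow_of_rpow_div_le (pe_pos hn (by omega)) hs ?_
    have := Finset.single_le_sum (f := fun j => |d j| ^ (2 * pe n 2 / pe n (j + 1)))
      (fun _ _ => by positivity) (Finset.mem_Icc.2 ⟨h1, h2⟩)
    exact this.trans (le_add_of_nonneg_left hS1)
  obtain ⟨D, hD, hDle⟩ := hLD γ y t M hM (fun k _ _ => hγ k)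
    (fun k h1 h2 => by rw [hx]; exact hω k h1 (by omega)) (fun k h1 h2 => by
      rw [hy k h1 h2, add_mul, one_mul]
      exact (abs_add_le _ _).trans (add_le_add
        (hB k (by omega) x M hM fun m h3 h4 => hω m h3 (by omega)) (hd k h1 (by omega))))
  refine ⟨D, hD, ?_⟩
  set r := |omfb n l (j + 2) x| ^ (1 / qe n (j + 2)) with hr
  have hr0 : 0 ≤ r := by positivity
  have hrs : r ^ (2 * pe n 2) = |omfb n l (j + 2) x| ^ (2 * pe n 2 / qe n (j + 2)) := by
    rw [hr, ← Real.rpow_mul (abs_nonneg _), one_div_mul_eq_div]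
  have h1 := hY₁ r M hr0 hM
  have h2 := hY₂ (omfb n l (j + 2) x) (d (j + 2)) M hM (hd (j + 2) (by omega) le_rfl)
  have h3 : omfb n l (j + 1) x * (x (j + 2) - vfb n l (j + 1) x) +
      (vfb n l (j + 1) x - x (j + 2)) * D ≤
      2 * (1 + L) * (r ^ pe n (j + 2) * M ^ qe n (j + 1)) := by
    calc _ = (vfb n l (j + 1) x - x (j + 2)) * (D - omfb n l (j + 1) x) := by ring
      _ ≤ |vfb n l (j + 1) x - x (j + 2)| * |D - omfb n l (j + 1) x| := by
        rw [← abs_mul]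
        exact le_abs_self _
      _ ≤ 2 * r ^ pe n (j + 2) * ((1 + L) * M ^ qe n (j + 1)) := by
        gcongr
        · exact abs_vfb_sub_le hn hi1 (by omega) x
        · linarith [abs_sub D (omfb n l (j + 1) x), hω (j + 1) hi1 (by omega)]
      _ = _ := by ring
  rw [hMS] at h1 h2
  rw [hrs] at h1
  have h4 := mul_le_mul_of_nonneg_left h1 (by positivity : 0 ≤ 2 * (1 + L))
  have h5 : 2 * (1 + L) * (δ / 2 / (2 * (1 + L)) * S +
      K₁ * |omfb n l (j + 2) x| ^ (2 * pe n 2 / qe n (j + 2))) =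
      δ / 2 * S + 2 * (1 + L) * K₁ * |omfb n l (j + 2) x| ^ (2 * pe n 2 / qe n (j + 2)) := by
    field_simp
  linarith

/-- The backstepping inequality along curves, with an arbitrary fraction `c < 1` of the
nominal dissipation. -/
lemma exists_gains (hn : 2 ≤ n) (hi1 : 1 ≤ i) (hi : i < n) {c : ℝ} (hc : c < 1) :
    ∃ (l : ℕ → ℝ) (C : ℝ), (∀ j, 0 < l j) ∧ 0 < C ∧
      ∀ (γ : ℝ → ℕ → ℝ) (x y d : ℕ → ℝ) (t z : ℝ), γ t = x →
        (∀ k, HasDerivAt (fun s => γ s k) (y k) t) →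
        (∀ k, 1 ≤ k → k < i → y k = x (k + 1) + d k) → y i = z + d i →
        ∃ D, HasDerivAt (fun s => ∑ j ∈ Finset.Icc 1 i, Wfb n l j (γ s)) D t ∧
          D ≤ -(∑ j ∈ Finset.Icc 1 i, c * l j * |omfb n l j x| ^ (2 * pe n 2 / qe n j)) +
            omfb n l i x * (z - vfb n l i x) +
            C * ∑ j ∈ Finset.Icc 1 i, |d j| ^ (2 * pe n 2 / pe n (j + 1)) := by
  have hs : 0 < 2 * pe n 2 := mul_pos two_pos (pe_pos hn hn)
  induction i, hi1 using Nat.le_induction generalizing c with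
  | base =>
    have hp : 0 < pe n 2 := pe_pos hn hn
    obtain ⟨K, hK, hY⟩ := exists_mul_le_rpow (qe_pos hn le_rfl) hp (qe_add_pe_succ hn 1) one_pos
    set l : ℕ → ℝ := fun _ => (K + 1) / (1 - c)
    refine ⟨l, 1, fun _ => div_pos (by linarith) (by linarith), one_pos,
      fun γ x y d t z hx hγ _ hy => ⟨omfb n l 1 x * y 1, ?_, ?_⟩⟩
    · simp only [Finset.Icc_self, Finset.sum_singleton]
      refine (hasDerivAt_Wfb (D := 0) hn (by omega) (hγ 1) ?_).congr_deriv ?_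
      · simpa only [vpow_zero] using hasDerivAt_const t (0 : ℝ)
      · rw [hx, mul_zero, add_zero]
    · have hl1 : l 1 * (1 - c) = K + 1 := div_mul_cancel₀ _ (by linarith)
      have h1 := omfb_mul_vfb (l := l) hn (j := 0) (by omega) x
      have h2 := hY (omfb n l 1 x) (d 1) ((|d 1| ^ (2 * pe n 2 / pe n 2)) ^ (1 / (2 * pe n 2)))
        (by positivity) (abs_le_rpow_of_rpow_div_le hp hs le_rfl)
      rw [← Real.rpow_mul (by positivity), one_div_mul_cancel hs.ne', Real.rpow_one] at h2
      simp only [Finset.Icc_self, Finset.sum_singleton, zero_add] at h1 ⊢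
      have h3 : 0 ≤ |omfb n l 1 x| ^ (2 * pe n 2 / qe n 1) := by positivity
      rw [hy]
      simp only [Nat.reduceAdd]
      have h4 : c * l 1 * |omfb n l 1 x| ^ (2 * pe n 2 / qe n 1) =
          l 1 * |omfb n l 1 x| ^ (2 * pe n 2 / qe n 1) -
            (K + 1) * |omfb n l 1 x| ^ (2 * pe n 2 / qe n 1) := by
        rw [← hl1]
        ring
      linarith
  | succ i hi1 ih =>
    obtain ⟨l₀, C, hl₀, hC, hV⟩ := ih (by omega) (c := (1 + c) / 2) (by linarith)
    obtain ⟨m, -, hm⟩ := Finset.exists_min_image (Finset.Icc 1 i) l₀ ⟨1, by simp [hi1]⟩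
    set δ := (1 - c) / 2 * l₀ m with hδdef
    have hδ : 0 < δ := mul_pos (by linarith) (hl₀ m)
    obtain ⟨K, hK, hcross⟩ := exists_cross_terms_le hn hl₀ hi1 hi hδ
    set l := Function.update l₀ (i + 1) ((K + δ) / (1 - c)) with hl
    have hll : ∀ k < i + 1, l k = l₀ k := fun k hk => Function.update_of_ne (by omega) _ _
    have hltop : l (i + 1) * (1 - c) = K + δ := by
      rw [hl, Function.update_self, div_mul_cancel₀ _ (by linarith)]
    have hωl : ∀ k, 1 ≤ k → k ≤ i + 1 → ∀ x, omfb n l k x = omfb n l₀ k x := fun k h1 h2 x =>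
      omfb_congr (fun j hj => hll j (by omega)) h1 x
    refine ⟨l, C + δ, fun j => ?_, by positivity, fun γ x y d t z hx hγ hy hyi => ?_⟩
    · rcases eq_or_ne j (i + 1) with rfl | hj
      · rw [hl, Function.update_self]
        exact div_pos (by linarith) (by linarith)
      · rw [hl, Function.update_of_ne hj]
        exact hl₀ j
    obtain ⟨DV, hDV, hDVle⟩ := hV γ x y d t (x (i + 1)) hx hγ
      (fun k h1 h2 => hy k h1 (by omega)) (hy i hi1 (by omega))
    obtain ⟨D, hD, hDle⟩ := hcross γ x y d t hx hγ (fun k h1 h2 => hy k h1 (by omega))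
    have hW := hasDerivAt_Wfb hn (by omega) (hγ (i + 1)) hD
    rw [hx] at hW
    refine ⟨_, (hDV.add hW).congr_of_eventuallyEq (Eventually.of_forall fun s => ?_), ?_⟩
    · simp only [Pi.add_apply]
      rw [Finset.sum_Icc_succ_top (by omega), Wfb_congr (l' := l₀) hll (by omega)]
      congr 1
      refine Finset.sum_congr rfl fun j hj => ?_
      rw [Finset.mem_Icc] at hj
      exact Wfb_congr (fun k hk => hll k (by omega)) hj.1 _
    · have hωv := omfb_mul_vfb (l := l) hn hi x
      rw [hωl _ (by omega) le_rfl] at hωv ⊢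
      rw [Finset.sum_Icc_succ_top (by omega), Finset.sum_Icc_succ_top (by omega)] at hDle ⊢
      rw [hωl _ (by omega) le_rfl]
      have hdiss : ∑ j ∈ Finset.Icc 1 i, c * l j * |omfb n l j x| ^ (2 * pe n 2 / qe n j) +
          δ * ∑ j ∈ Finset.Icc 1 i, |omfb n l₀ j x| ^ (2 * pe n 2 / qe n j) ≤
          ∑ j ∈ Finset.Icc 1 i, (1 + c) / 2 * l₀ j * |omfb n l₀ j x| ^ (2 * pe n 2 / qe n j) := by
        rw [Finset.mul_sum, ← Finset.sum_add_distrib]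
        refine Finset.sum_le_sum fun j hj => ?_
        have hmj := hm j hj
        rw [Finset.mem_Icc] at hj
        rw [hωl j hj.1 (by omega), hll j (by omega), ← add_mul]
        refine mul_le_mul_of_nonneg_right ?_ (by positivity)
        nlinarith
      set a := |omfb n l₀ (i + 1) x| ^ (2 * pe n 2 / qe n (i + 1))
      have htop : c * l (i + 1) * a = l (i + 1) * a - (K + δ) * a := by
        rw [← hltop]
        ring
      have hb : 0 ≤ |d (i + 1)| ^ (2 * pe n 2 / pe n (i + 1 + 1)) := by positivity
      have hCb := mul_nonneg hC.le hb
      rw [hyi]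
      linarith

end Backstepping

lemma contDiff_emb (i k : ℕ) : ContDiff ℝ 1 fun x : Fin i → ℝ => emb i x k := by
  unfold emb
  split_ifs
  · exact contDiff_apply ℝ ℝ _
  · exact contDiff_const

lemma contDiff_Vi {n i : ℕ} {l : ℕ → ℝ} (hn : 2 ≤ n) (hl : ∀ j, 0 < l j) (hi : i ≤ n) :
    ContDiff ℝ 1 (Vi n i l) := by
  refine ContDiff.sum fun j hj => ?_
  rw [Finset.mem_Icc] at hj
  obtain ⟨k, rfl⟩ : ∃ k, j = k + 1 := ⟨j - 1, by omega⟩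
  exact contDiff_Wfb hn hl (contDiff_emb i) (by omega)

/-- inductive inequality: for each `1 ≤ i ≤ n-1` there exist positive
gains `l_1,…,l_i` and `C_i > 0` such that `V_i` is `C¹` away from the origin of `ℝ^i`
and for all `(x_1,…,x_i) ≠ 0`, `x_{i+1} ∈ ℝ`, `(d_1,…,d_i) ∈ ℝ^i`:
`Σ_j ∂V_i/∂x_j (x_{j+1} + d_j) ≤ -Σ_j (l_j/2)|ω_j|^{α_j} + ω_i (x_{i+1} - v_i) + C_i Σ_j |d_j|^{η_j}`,
with `α_j = 2p₂/(1+p₂-p_j)` and `η_j = 2p₂/p_{j+1}`. -/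
theorem inductive_backstepping_inequality (n : ℕ) (hn : 0 < n)
    (i : ℕ) (hi1 : 1 ≤ i) (hi2 : i ≤ n - 1) :
    ∃ (l : ℕ → ℝ) (C : ℝ), (∀ j, 0 < l j) ∧ 0 < C ∧
      ContDiffOn ℝ 1 (Vi n i l) {(0 : Fin i → ℝ)}ᶜ ∧
      ∀ x : Fin i → ℝ, x ≠ 0 → ∀ xnext : ℝ, ∀ d : Fin i → ℝ,
        fderiv ℝ (Vi n i l) x
            (fun j : Fin i =>
              (if h : (j : ℕ) + 1 < i then x ⟨(j : ℕ) + 1, h⟩ else xnext) + d j) ≤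
          -(∑ j ∈ Finset.Icc 1 i,
              l j / 2 * |omfb n l j (emb i x)| ^ (2 * pe n 2 / (1 + pe n 2 - pe n j))) +
            omfb n l i (emb i x) * (xnext - vfb n l i (emb i x)) +
            C * ∑ j ∈ Finset.Icc 1 i, |emb i d j| ^ (2 * pe n 2 / pe n (j + 1)) := by
  have hn2 : 2 ≤ n := by omega
  obtain ⟨l, C, hl, hC, hV⟩ := exists_gains hn2 hi1 (by omega) (c := 1 / 2) (by norm_num)
  have hsmooth : ContDiff ℝ 1 (Vi n i l) := contDiff_Vi hn2 hl (by omega)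
  refine ⟨l, C, hl, hC, hsmooth.contDiffOn, fun x _ z d => ?_⟩
  set w : Fin i → ℝ := fun j =>
    (if h : (j : ℕ) + 1 < i then x ⟨(j : ℕ) + 1, h⟩ else z) + d j with hw
  have hline : HasDerivAt (fun s : ℝ => x + s • w) w 0 := by
    simpa using ((hasDerivAt_id (0 : ℝ)).smul_const w).const_add x
  obtain ⟨D, hD, hDle⟩ := hV (fun s => emb i (x + s • w)) (emb i x) (emb i w) (emb i d) 0 z
    (by simp)
    (fun k => by
      unfold emb
      split_ifs
      · exact hasDerivAt_pi.1 hline _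
      · exact hasDerivAt_const _ _)
    (fun k h1 h2 => by
      have h3 : k - 1 + 1 = k := by omega
      simp [emb, hw, h1, h2, h2.le, h3, Nat.succ_le_of_lt h2])
    (by
      have h3 : i - 1 + 1 = i := by omega
      simp [emb, hw, hi1, h3])
  have hF : HasFDerivAt (Vi n i l) (fderiv ℝ (Vi n i l) x) (x + (0 : ℝ) • w) := by
    simpa using (hsmooth.differentiable one_ne_zero x).hasFDerivAt
  have hDV : HasDerivAt (Vi n i l ∘ fun s : ℝ => x + s • w) D 0 := hD
  rw [(hF.comp_hasDerivAt (0 : ℝ) hline).unique hDV]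
  refine hDle.trans_eq ?_
  simp only [qe, one_div_mul_eq_div]
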